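/- Let X be an N×N real matrix, let α ∈ ℝ^N have nonnegative entries, and for each n let f_n : ℝ → ℝ be Lipschitz with constant α_n, i.e., |f_n(u) − f_n(u')| ≤ α_n|u − u'| for all u, u'. Define f : ℝ^N → ℝ^N componentwise by f(v)_n = f_n(v_n), and for a fixed vector ṽ ∈ ℝ^N define T(q) = f(Xq + ṽ). If ρ := ‖diag(α)·X‖₂ < 1, then T is a contraction on ℝ^N with Lipschitz constant ρ in the Euclidean norm; hence T has a unique fixed point q_eq, and for every initial q⁰ the iterates q^{t+1} = T(q^t) satisfy ‖q^t − q_eq‖₂ ≤ ρ^t ‖q⁰ − q_eq‖₂ and converge to q_eq. -/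

import Mathlib

open Matrix Filter

/-- The ℓ₂ operator norm (largest singular value) of a real square matrix. -/
noncomputable def l2OpNorm {N : ℕ} (M : Matrix (Fin N) (Fin N) ℝ) : ℝ :=
  ‖Matrix.toEuclideanCLM (𝕜 := ℝ) M‖

theorem EuclideanSpace.norm_le_norm_of_forall_abs_le {ι : Type*} [Fintype ι]
    {x y : EuclideanSpace ℝ ι} (h : ∀ i, |x i| ≤ |y i|) : ‖x‖ ≤ ‖y‖ := by
  rw [EuclideanSpace.norm_eq, EuclideanSpace.norm_eq]
  gcongr with i
  exact h i

theorem norm_sub_le_l2OpNorm_diagonal_mul {N : ℕ} {X : Matrix (Fin N) (Fin N) ℝ}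
    {α : Fin N → ℝ} {f : Fin N → ℝ → ℝ} {w : Fin N → ℝ}
    (hα : ∀ n, 0 ≤ α n) (hLip : ∀ n u u', |f n u - f n u'| ≤ α n * |u - u'|)
    {T : EuclideanSpace ℝ (Fin N) → EuclideanSpace ℝ (Fin N)}
    (hT : ∀ q n, T q n = f n (X.mulVec q n + w n)) (q q' : EuclideanSpace ℝ (Fin N)) :
    ‖T q - T q'‖ ≤ l2OpNorm (Matrix.diagonal α * X) * ‖q - q'‖ := by
  refine le_trans (EuclideanSpace.norm_le_norm_of_forall_abs_le fun n => ?_)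
    ((Matrix.toEuclideanCLM (𝕜 := ℝ) (Matrix.diagonal α * X)).le_opNorm (q - q'))
  rw [Matrix.ofLp_toEuclideanCLM, ← Matrix.mulVec_mulVec, Matrix.mulVec_diagonal, abs_mul,
    abs_of_nonneg (hα n), PiLp.sub_apply, hT, hT, WithLp.ofLp_sub, Matrix.mulVec_sub,
    Pi.sub_apply]
  simpa only [add_sub_add_right_eq_sub] using
    hLip n (X.mulVec q n + w n) (X.mulVec q' n + w n)

/-- If each `f n` is Lipschitz with constant `α n` and `ρ := ‖diag(α) X‖₂ < 1`, then
the Volt/VAR iteration map `T q = f (X q + vtil)` is a `ρ`-contraction in the Euclidean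
norm, has a unique fixed point, and iterates converge to it geometrically. -/
theorem stmt_5 {N : ℕ} (X : Matrix (Fin N) (Fin N) ℝ) (α : Fin N → ℝ)
    (f : Fin N → ℝ → ℝ) (vtil : Fin N → ℝ) (ρ : ℝ)
    (hα : ∀ n, 0 ≤ α n)
    (hLip : ∀ n u u', |f n u - f n u'| ≤ α n * |u - u'|)
    (T : EuclideanSpace ℝ (Fin N) → EuclideanSpace ℝ (Fin N))
    (hT : ∀ q n, T q n = f n (X.mulVec q n + vtil n))
    (hρdef : ρ = l2OpNorm (Matrix.diagonal α * X)) (hρ : ρ < 1) :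
    (∀ q q', ‖T q - T q'‖ ≤ ρ * ‖q - q'‖) ∧
    (∃! qeq, T qeq = qeq) ∧
    (∀ qeq, T qeq = qeq → ∀ q0 : EuclideanSpace ℝ (Fin N),
      (∀ t : ℕ, ‖T^[t] q0 - qeq‖ ≤ ρ ^ t * ‖q0 - qeq‖) ∧
      Tendsto (fun t : ℕ => T^[t] q0) atTop (nhds qeq)) := by
  have hbound : ∀ q q', ‖T q - T q'‖ ≤ ρ * ‖q - q'‖ := fun q q' =>
    hρdef ▸ norm_sub_le_l2OpNorm_diagonal_mul hα hLip hT q q'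
  have hρ_nonneg : 0 ≤ ρ := hρdef ▸ norm_nonneg _
  lift ρ to NNReal using hρ_nonneg
  have hcontr : ContractingWith ρ T :=
    ⟨by exact_mod_cast hρ, LipschitzWith.of_dist_le_mul fun q q' => by
      simpa only [dist_eq_norm] using hbound q q'⟩
  refine ⟨hbound, ⟨hcontr.fixedPoint T, hcontr.fixedPoint_isFixedPt,
    fun _ hq => hcontr.fixedPoint_unique hq⟩, fun qeq hq q0 => ⟨fun t => ?_, ?_⟩⟩
  · have h := (hcontr.toLipschitzWith.iterate t).dist_le_mul q0 qeq
    rwa [Function.iterate_fixed hq, dist_eq_norm, dist_eq_norm, NNReal.coe_pow] at h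
  · rw [hcontr.fixedPoint_unique hq]
    exact hcontr.tendsto_iterate_fixedPoint q0
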